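/- For every integer n ≥ 1, the following identity holds in ℤ[p,q,t]: Σ_{σ∈D_n} p^{nest σ} q^{cros σ} t^{exc σ} = Σ_{k=0}^{⌊n/2⌋} b_{n,k,0}(p,q) · t^k · (1+qt)^{n−2k}, where b_{n,k,0}(p,q) = Σ_{σ∈D_{n,k}} p^{nest σ} q^{cros σ} and D_{n,k} is the set of derangements of [n] with exactly k cyclic valleys and no double excedances. -/

import Mathlib

open scoped Classical
open Finset

noncomputable section

namespace SZpaper

/-- `σ` as a 1-indexed function on `[1,n]`, extended by `0` elsewhere
(boundary convention `σ(0)=σ(n+1)=0`). -/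
def pext (n : ℕ) (σ : Equiv.Perm (Fin n)) (i : ℕ) : ℕ :=
  if h : 1 ≤ i ∧ i ≤ n then ((σ ⟨i - 1, by omega⟩ : Fin n) : ℕ) + 1 else 0

/-- `σ` extended with the Brändén boundary convention `σ(0)=σ(n+1)=n+1`. -/
def pextB (n : ℕ) (σ : Equiv.Perm (Fin n)) (i : ℕ) : ℕ :=
  if h : 1 ≤ i ∧ i ≤ n then ((σ ⟨i - 1, by omega⟩ : Fin n) : ℕ) + 1 else n + 1

/-- `σ` extended with the boundary convention `σ(0)=0`, `σ(n+1)=n+1`. -/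
def pextC (n : ℕ) (σ : Equiv.Perm (Fin n)) (i : ℕ) : ℕ :=
  if h : 1 ≤ i ∧ i ≤ n then ((σ ⟨i - 1, by omega⟩ : Fin n) : ℕ) + 1
  else if i = 0 then 0 else n + 1

/-- The set of pairs `(i,j)` with `i, j ∈ [1,n]`. -/
def pairs (n : ℕ) : Finset (ℕ × ℕ) := Finset.Icc 1 n ×ˢ Finset.Icc 1 n

/-- `des σ = #{i ∈ [n−1] : σ(i) > σ(i+1)}`. -/
def desStat (n : ℕ) (σ : Equiv.Perm (Fin n)) : ℕ :=
  ((Finset.Icc 1 (n - 1)).filter fun i => pext n σ (i + 1) < pext n σ i).card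

/-- `les σ = #{(i,j) : 2 ≤ i < j ≤ n, σ(i−1) > σ(j) > σ(i)}`. -/
def lesStat (n : ℕ) (σ : Equiv.Perm (Fin n)) : ℕ :=
  ((pairs n).filter fun x => 2 ≤ x.1 ∧ x.1 < x.2 ∧
    pext n σ x.1 < pext n σ x.2 ∧ pext n σ x.2 < pext n σ (x.1 - 1)).card

/-- `less σ = #{(i,j) : 2 ≤ i < j ≤ n, σ(i−1) < σ(j) < σ(i)}`. -/
def lessStat (n : ℕ) (σ : Equiv.Perm (Fin n)) : ℕ :=
  ((pairs n).filter fun x => 2 ≤ x.1 ∧ x.1 < x.2 ∧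
    pext n σ (x.1 - 1) < pext n σ x.2 ∧ pext n σ x.2 < pext n σ x.1).card

/-- `res σ = #{(i,j) : 1 ≤ i < j ≤ n−1, σ(j+1) > σ(i) > σ(j)}`. -/
def resStat (n : ℕ) (σ : Equiv.Perm (Fin n)) : ℕ :=
  ((pairs n).filter fun x => x.1 < x.2 ∧ x.2 ≤ n - 1 ∧
    pext n σ x.2 < pext n σ x.1 ∧ pext n σ x.1 < pext n σ (x.2 + 1)).card

/-- `ress σ = #{(i,j) : 1 ≤ i < j ≤ n−1, σ(j+1) < σ(i) < σ(j)}`. -/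
def ressStat (n : ℕ) (σ : Equiv.Perm (Fin n)) : ℕ :=
  ((pairs n).filter fun x => x.1 < x.2 ∧ x.2 ≤ n - 1 ∧
    pext n σ (x.2 + 1) < pext n σ x.1 ∧ pext n σ x.1 < pext n σ x.2).card

/-! Linear statistics with the boundary convention `σ(0)=σ(n+1)=0` (starred). -/

def peakStar (n : ℕ) (σ : Equiv.Perm (Fin n)) : ℕ :=
  ((Finset.Icc 1 n).filter fun i =>
    pext n σ (i - 1) < pext n σ i ∧ pext n σ (i + 1) < pext n σ i).card

def valleyStar (n : ℕ) (σ : Equiv.Perm (Fin n)) : ℕ :=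
  ((Finset.Icc 1 n).filter fun i =>
    pext n σ i < pext n σ (i - 1) ∧ pext n σ i < pext n σ (i + 1)).card

def daStar (n : ℕ) (σ : Equiv.Perm (Fin n)) : ℕ :=
  ((Finset.Icc 1 n).filter fun i =>
    pext n σ (i - 1) < pext n σ i ∧ pext n σ i < pext n σ (i + 1)).card

def ddStar (n : ℕ) (σ : Equiv.Perm (Fin n)) : ℕ :=
  ((Finset.Icc 1 n).filter fun i =>
    pext n σ (i + 1) < pext n σ i ∧ pext n σ i < pext n σ (i - 1)).card

/-! Linear statistics with the Brändén boundary convention `σ(0)=σ(n+1)=n+1`. -/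

def peakB (n : ℕ) (σ : Equiv.Perm (Fin n)) : ℕ :=
  ((Finset.Icc 1 n).filter fun i =>
    pextB n σ (i - 1) < pextB n σ i ∧ pextB n σ (i + 1) < pextB n σ i).card

def valleyB (n : ℕ) (σ : Equiv.Perm (Fin n)) : ℕ :=
  ((Finset.Icc 1 n).filter fun i =>
    pextB n σ i < pextB n σ (i - 1) ∧ pextB n σ i < pextB n σ (i + 1)).card

def daB (n : ℕ) (σ : Equiv.Perm (Fin n)) : ℕ :=
  ((Finset.Icc 1 n).filter fun i =>
    pextB n σ (i - 1) < pextB n σ i ∧ pextB n σ i < pextB n σ (i + 1)).card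

def ddB (n : ℕ) (σ : Equiv.Perm (Fin n)) : ℕ :=
  ((Finset.Icc 1 n).filter fun i =>
    pextB n σ (i + 1) < pextB n σ i ∧ pextB n σ i < pextB n σ (i - 1)).card

/-! Linear statistics with the boundary convention `σ(0)=0`, `σ(n+1)=n+1`. -/

def valleyC (n : ℕ) (σ : Equiv.Perm (Fin n)) : ℕ :=
  ((Finset.Icc 1 n).filter fun i =>
    pextC n σ i < pextC n σ (i - 1) ∧ pextC n σ i < pextC n σ (i + 1)).card

def daC (n : ℕ) (σ : Equiv.Perm (Fin n)) : ℕ :=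
  ((Finset.Icc 1 n).filter fun i =>
    pextC n σ (i - 1) < pextC n σ i ∧ pextC n σ i < pextC n σ (i + 1)).card

def ddC (n : ℕ) (σ : Equiv.Perm (Fin n)) : ℕ :=
  ((Finset.Icc 1 n).filter fun i =>
    pextC n σ (i + 1) < pextC n σ i ∧ pextC n σ i < pextC n σ (i - 1)).card

/-- `fmax σ`: the number of double ascents (convention `σ(0)=0`, `σ(n+1)=n+1`)
which are left-to-right maxima. -/
def fmaxStat (n : ℕ) (σ : Equiv.Perm (Fin n)) : ℕ :=
  ((Finset.Icc 1 n).filter fun i =>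
    pextC n σ (i - 1) < pextC n σ i ∧ pextC n σ i < pextC n σ (i + 1) ∧
    ∀ j ∈ Finset.Ico 1 i, pext n σ j < pext n σ i).card

/-! Cyclic statistics. -/

def excStat (n : ℕ) (σ : Equiv.Perm (Fin n)) : ℕ :=
  ((Finset.Icc 1 n).filter fun i => i < pext n σ i).card

def wexStat (n : ℕ) (σ : Equiv.Perm (Fin n)) : ℕ :=
  ((Finset.Icc 1 n).filter fun i => i ≤ pext n σ i).card

def dropStat (n : ℕ) (σ : Equiv.Perm (Fin n)) : ℕ :=
  ((Finset.Icc 1 n).filter fun i => pext n σ i < i).card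

def fixStat (n : ℕ) (σ : Equiv.Perm (Fin n)) : ℕ :=
  ((Finset.Icc 1 n).filter fun i => pext n σ i = i).card

/-- cyclic valleys: `x` with `σ⁻¹(x) > x < σ(x)`. -/
def cvalleyStat (n : ℕ) (σ : Equiv.Perm (Fin n)) : ℕ :=
  ((Finset.Icc 1 n).filter fun x => x < pext n σ⁻¹ x ∧ x < pext n σ x).card

/-- double excedances: `x` with `σ⁻¹(x) < x < σ(x)`. -/
def cdaStat (n : ℕ) (σ : Equiv.Perm (Fin n)) : ℕ :=
  ((Finset.Icc 1 n).filter fun x => pext n σ⁻¹ x < x ∧ x < pext n σ x).card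

/-- double drops: `x` with `σ⁻¹(x) > x > σ(x)`. -/
def cddStat (n : ℕ) (σ : Equiv.Perm (Fin n)) : ℕ :=
  ((Finset.Icc 1 n).filter fun x => x < pext n σ⁻¹ x ∧ pext n σ x < x).card

/-- crossings. -/
def crosStat (n : ℕ) (σ : Equiv.Perm (Fin n)) : ℕ :=
  ((pairs n).filter fun x =>
    (x.1 < x.2 ∧ x.2 ≤ pext n σ x.1 ∧ pext n σ x.1 < pext n σ x.2) ∨
    (x.2 < x.1 ∧ pext n σ x.1 < x.2 ∧ pext n σ x.2 < pext n σ x.1)).card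

/-- nestings. -/
def nestStat (n : ℕ) (σ : Equiv.Perm (Fin n)) : ℕ :=
  ((pairs n).filter fun x =>
    (x.1 < x.2 ∧ x.2 ≤ pext n σ x.2 ∧ pext n σ x.2 < pext n σ x.1) ∨
    (x.2 < x.1 ∧ pext n σ x.2 < x.2 ∧ pext n σ x.1 < pext n σ x.2)).card

/-- number of cycles of `σ` (fixed points count as cycles). -/
def cycStat (n : ℕ) (σ : Equiv.Perm (Fin n)) : ℕ :=
  Multiset.card σ.cycleType + (Finset.univ.filter fun x => σ x = x).card

/-! Star statistics: `σ*(i) = σ(i) − 1`, a bijection `[n] → {0,…,n−1}`;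
we extend `σ*` by `0` outside `[1,n]`. -/

def starf (n : ℕ) (σ : Equiv.Perm (Fin n)) (i : ℕ) : ℕ :=
  if 1 ≤ i ∧ i ≤ n then pext n σ i - 1 else 0

/-- `(σ*)⁻¹(i) = σ⁻¹(i+1)`, defined for `0 ≤ i ≤ n−1`. -/
def invstarf (n : ℕ) (σ : Equiv.Perm (Fin n)) (i : ℕ) : ℕ :=
  pext n σ⁻¹ (i + 1)

def dropStarStat (n : ℕ) (σ : Equiv.Perm (Fin n)) : ℕ :=
  ((Finset.Icc 1 n).filter fun i => starf n σ i < i).card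

def fixStarStat (n : ℕ) (σ : Equiv.Perm (Fin n)) : ℕ :=
  ((Finset.Icc 1 n).filter fun i => starf n σ i = i).card

def wexStarStat (n : ℕ) (σ : Equiv.Perm (Fin n)) : ℕ :=
  ((Finset.Icc 1 n).filter fun i => i ≤ starf n σ i).card

def cdaStarStat (n : ℕ) (σ : Equiv.Perm (Fin n)) : ℕ :=
  ((Finset.Icc 1 n).filter fun i => invstarf n σ i < i ∧ i < starf n σ i).card

def cddStarStat (n : ℕ) (σ : Equiv.Perm (Fin n)) : ℕ :=
  ((Finset.Icc 1 n).filter fun i => i < invstarf n σ i ∧ starf n σ i < i).card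

def cvalleyStarStat (n : ℕ) (σ : Equiv.Perm (Fin n)) : ℕ :=
  ((Finset.Icc 1 n).filter fun i => i < invstarf n σ i ∧ i < starf n σ i).card

def crosStarStat (n : ℕ) (σ : Equiv.Perm (Fin n)) : ℕ :=
  ((pairs n).filter fun x =>
    (x.1 < x.2 ∧ x.2 ≤ starf n σ x.1 ∧ starf n σ x.1 < starf n σ x.2) ∨
    (x.2 < x.1 ∧ starf n σ x.1 < x.2 ∧ starf n σ x.2 < starf n σ x.1)).card

def nestStarStat (n : ℕ) (σ : Equiv.Perm (Fin n)) : ℕ :=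
  ((pairs n).filter fun x =>
    (x.1 < x.2 ∧ x.2 ≤ starf n σ x.2 ∧ starf n σ x.2 < starf n σ x.1) ∨
    (x.2 < x.1 ∧ starf n σ x.2 < x.2 ∧ starf n σ x.1 < starf n σ x.2)).card

/-- `cyc* σ`: the number of cycles of the functional digraph of `σ*` on `[n]`,
counted as the number of `i ∈ [1,n]` that lie on a cycle of `σ*` and are
minimal in their cycle. (The component of `σ*` that is a path from `n` to `0`
contributes no such `i`.) -/
def cycStarStat (n : ℕ) (σ : Equiv.Perm (Fin n)) : ℕ :=
  ((Finset.Icc 1 n).filter fun i =>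
    (∃ m ∈ Finset.Icc 1 n, (starf n σ)^[m] i = i) ∧
    ∀ m ∈ Finset.range (n + 1), i ≤ (starf n σ)^[m] i).card

/-! Motzkin paths, encoded as step sequences `γ : Fin m → Fin 3`
(`0` = up step `(1,1)`, `1` = level step `(1,0)`, `2` = down step `(1,−1)`). -/

/-- The height (ordinate) of the path after `i` steps. -/
def hgt (m : ℕ) (γ : Fin m → Fin 3) (i : ℕ) : ℤ :=
  ∑ j ∈ Finset.range i, if hj : j < m then 1 - ((γ ⟨j, hj⟩ : ℕ) : ℤ) else 0

/-- A step sequence is a Motzkin path if it never goes below the x-axis and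
ends at height `0`. -/
def IsMotzkin (m : ℕ) (γ : Fin m → Fin 3) : Prop :=
  (∀ i ≤ m, 0 ≤ hgt m γ i) ∧ hgt m γ m = 0

/-- The (finite) set of Motzkin paths of length `m`. -/
def motzkin (m : ℕ) : Finset (Fin m → Fin 3) :=
  Finset.univ.filter fun γ => IsMotzkin m γ

/-- number of up (North-East) steps. -/
def neCount (m : ℕ) (γ : Fin m → Fin 3) : ℕ :=
  (Finset.univ.filter fun i => γ i = 0).card

/-- number of level (East) steps. -/
def eCount (m : ℕ) (γ : Fin m → Fin 3) : ℕ :=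
  (Finset.univ.filter fun i => γ i = 1).card

/-- the `(p,q)`-integer `[m]_{p,q} = p^{m−1} + p^{m−2}q + ⋯ + q^{m−1}`. -/
def pqInt {R : Type*} [CommRing R] (p q : R) (m : ℕ) : R :=
  ∑ j ∈ Finset.range m, p ^ (m - 1 - j) * q ^ j

open MvPolynomial in
/-- `b_{n,k,0}(p,q)` (with `p = X 0`, `q = X 1`), as an element of `ℤ[p,q,t]`:
the sum over derangements of `[n]` with exactly `k` cyclic valleys and no
double excedances. -/
def bPoly0 (n k : ℕ) : MvPolynomial (Fin 3) ℤ :=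
  ∑ σ ∈ Finset.univ.filter
      (fun σ : Equiv.Perm (Fin n) =>
        fixStat n σ = 0 ∧ cvalleyStat n σ = k ∧ cdaStat n σ = 0),
    X 0 ^ nestStat n σ * X 1 ^ crosStat n σ

/-! Matchings between a set of openers and a set of closers. -/

/-- `M` is a set of arcs `(o, c)`, `o < c`, matching the openers `O` with the closers `C`. -/
def IsMatching (O C : Finset ℕ) (M : Finset (ℕ × ℕ)) : Prop :=
  (∀ a ∈ M, a.1 ∈ O ∧ a.2 ∈ C ∧ a.1 < a.2) ∧
  (∀ o ∈ O, ∃ c, (o, c) ∈ M) ∧ (∀ c ∈ C, ∃ o, (o, c) ∈ M) ∧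
  (∀ a ∈ M, ∀ b ∈ M, a.1 = b.1 → a = b) ∧ (∀ a ∈ M, ∀ b ∈ M, a.2 = b.2 → a = b)

/-- The finite set of all matchings of `O` with `C`. -/
def matchings (O C : Finset ℕ) : Finset (Finset (ℕ × ℕ)) :=
  (O ×ˢ C).powerset.filter (IsMatching O C)

/-- The number of pairs of nested arcs. -/
def arcNest (M : Finset (ℕ × ℕ)) : ℕ :=
  ((M ×ˢ M).filter fun x => x.1.1 < x.2.1 ∧ x.2.2 < x.1.2).card

/-- The number of pairs of (properly) crossing arcs. -/
def arcCros (M : Finset (ℕ × ℕ)) : ℕ :=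
  ((M ×ˢ M).filter fun x => x.1.1 < x.2.1 ∧ x.2.1 < x.1.2 ∧ x.1.2 < x.2.2).card

/-- The generating polynomial of matchings by nestings and crossings. -/
def matchSum {R : Type*} [CommRing R] (p q : R) (O C : Finset ℕ) : R :=
  ∑ M ∈ matchings O C, p ^ arcNest M * q ^ arcCros M

/-- The excess of openers over closers strictly before `c`. -/
def openCount (O C : Finset ℕ) (c : ℕ) : ℕ :=
  (O.filter (· < c)).card - (C.filter (· < c)).card

lemma mem_matchings {O C : Finset ℕ} {M : Finset (ℕ × ℕ)} :
    M ∈ matchings O C ↔ IsMatching O C M := by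
  simp only [matchings, mem_filter, mem_powerset, and_iff_right_iff_imp]
  intro h a ha
  exact mem_product.2 ⟨(h.1 a ha).1, (h.1 a ha).2.1⟩

lemma pqInt_succ {R : Type*} [CommRing R] (p q : R) (m : ℕ) :
    pqInt p q (m + 1) = pqInt p q m * q + p ^ m := by
  rw [pqInt, sum_range_succ', pqInt, sum_mul]
  congr 1
  · refine sum_congr rfl fun j _ => ?_
    rw [pow_succ, mul_assoc]
    congr 2
    omega
  · simp

lemma sum_pow_card_lt_mul_pow_card_gt {R : Type*} [CommRing R] (p q : R) (S : Finset ℕ) :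
    ∑ o ∈ S, p ^ (S.filter (· < o)).card * q ^ (S.filter (o < ·)).card = pqInt p q S.card := by
  induction S using Finset.induction_on_max with
  | empty => simp [pqInt]
  | insert a s h ih =>
    have ha : a ∉ s := fun h' => (h a h').false
    rw [sum_insert ha, card_insert_of_notMem ha, pqInt_succ, ← ih, add_comm, sum_mul]
    congr 1
    · refine sum_congr rfl fun o ho => ?_
      have h1 : (insert a s).filter (· < o) = s.filter (· < o) := by
        rw [filter_insert, if_neg (h o ho).not_gt]
      have h2 : (insert a s).filter (o < ·) = insert a (s.filter (o < ·)) := by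
        rw [filter_insert, if_pos (h o ho)]
      rw [h1, h2, card_insert_of_notMem (by simp [ha]), pow_succ, mul_assoc]
    · have h1 : (insert a s).filter (· < a) = s := by
        rw [filter_insert, if_neg (lt_irrefl a), filter_true_of_mem h]
      have h2 : (insert a s).filter (a < ·) = ∅ := by
        rw [filter_eq_empty_iff]
        intro x hx
        rcases mem_insert.1 hx with rfl | hx
        · exact lt_irrefl _
        · exact (h x hx).not_gt
      rw [h1, h2]
      simp

lemma IsMatching.image_fst {O C : Finset ℕ} {M : Finset (ℕ × ℕ)} (h : IsMatching O C M) :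
    M.image Prod.fst = O := by
  ext o
  simp only [mem_image]
  constructor
  · rintro ⟨a, ha, rfl⟩
    exact (h.1 a ha).1
  · intro ho
    obtain ⟨c, hc⟩ := h.2.1 o ho
    exact ⟨_, hc, rfl⟩

lemma IsMatching.card_filter_fst {O C : Finset ℕ} {M : Finset (ℕ × ℕ)} (h : IsMatching O C M)
    (P : ℕ → Prop) [DecidablePred P] : (M.filter fun a => P a.1).card = (O.filter P).card := by
  rw [← h.image_fst, filter_image, card_image_of_injOn]
  intro a ha b hb hab
  simp only [coe_filter, Set.mem_ofPred_eq] at ha hb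
  exact h.2.2.2.1 a ha.1 b hb.1 hab

section InsertArc

variable {O C : Finset ℕ} {M : Finset (ℕ × ℕ)} {o c : ℕ}

lemma arcNest_insert (hM : IsMatching (O.erase o) C M) (hc : ∀ x ∈ C, c < x) :
    arcNest (insert (o, c) M) = (O.filter (· < o)).card + arcNest M := by
  have h1 : ((insert (o, c) M ×ˢ insert (o, c) M).filter
      fun x => x.1.1 < x.2.1 ∧ x.2.2 < x.1.2) =
      (M.filter fun a => a.1 < o).image (fun a => (a, (o, c))) ∪
      (M ×ˢ M).filter fun x => x.1.1 < x.2.1 ∧ x.2.2 < x.1.2 := by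
    ext ⟨a, b⟩
    have := hM.1 a
    have := hM.1 b
    simp only [mem_filter, mem_product, mem_insert, mem_union, mem_image, Prod.ext_iff]
    grind
  have h2 : O.filter (· < o) = (O.erase o).filter (· < o) := by
    ext x
    simp only [mem_filter, mem_erase]
    grind
  have hno : (o, c) ∉ M := fun h => by simpa using (hM.1 _ h).1
  rw [arcNest, h1, card_union_of_disjoint, card_image_of_injective, arcNest, h2,
    hM.card_filter_fst (· < o)]
  · intro a b hab
    exact (Prod.ext_iff.1 hab).1
  · rw [Finset.disjoint_left]
    rintro ⟨a, b⟩ h h'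
    simp only [mem_filter, mem_product, mem_image, Prod.mk.injEq] at h h'
    grind

lemma arcCros_insert (hM : IsMatching (O.erase o) C M) (hc : ∀ x ∈ C, c < x) :
    arcCros (insert (o, c) M) = (O.filter fun x => o < x ∧ x < c).card + arcCros M := by
  have h1 : ((insert (o, c) M ×ˢ insert (o, c) M).filter
      fun x => x.1.1 < x.2.1 ∧ x.2.1 < x.1.2 ∧ x.1.2 < x.2.2) =
      (M.filter fun a => o < a.1 ∧ a.1 < c).image (fun a => ((o, c), a)) ∪
      (M ×ˢ M).filter fun x => x.1.1 < x.2.1 ∧ x.2.1 < x.1.2 ∧ x.1.2 < x.2.2 := by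
    ext ⟨a, b⟩
    have := hM.1 a
    have := hM.1 b
    simp only [mem_filter, mem_product, mem_insert, mem_union, mem_image, Prod.ext_iff]
    grind
  have h2 : (O.filter fun x => o < x ∧ x < c) =
      (O.erase o).filter fun x => o < x ∧ x < c := by
    ext x
    simp only [mem_filter, mem_erase]
    grind
  have hno : (o, c) ∉ M := fun h => by simpa using (hM.1 _ h).1
  rw [arcCros, h1, card_union_of_disjoint, card_image_of_injective, arcCros, h2,
    hM.card_filter_fst fun x => o < x ∧ x < c]
  · intro a b hab
    exact (Prod.ext_iff.1 hab).2
  · rw [Finset.disjoint_left]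
    rintro ⟨a, b⟩ h h'
    simp only [mem_filter, mem_product, mem_image, Prod.mk.injEq] at h h'
    grind

lemma IsMatching.insert_arc (hM : IsMatching (O.erase o) C M) (hc : c ∉ C) (ho : o ∈ O)
    (hoc : o < c) : IsMatching O (insert c C) (insert (o, c) M) := by
  obtain ⟨h1, h2, h3, h4, h5⟩ := hM
  refine ⟨?_, ?_, ?_, ?_, ?_⟩
  · intro a ha
    have := h1 a
    grind
  · intro x hx
    by_cases hxo : x = o
    · exact ⟨c, by simp [hxo]⟩
    · obtain ⟨d, hd⟩ := h2 x (mem_erase.2 ⟨hxo, hx⟩)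
      exact ⟨d, mem_insert_of_mem hd⟩
  · intro x hx
    rcases mem_insert.1 hx with rfl | hx
    · exact ⟨o, by simp⟩
    · obtain ⟨d, hd⟩ := h3 x hx
      exact ⟨d, mem_insert_of_mem hd⟩
  · intro a ha b hb
    have := h1 a
    have := h1 b
    have := h4 a
    grind
  · intro a ha b hb
    have := h1 a
    have := h1 b
    have := h5 a
    grind

lemma IsMatching.erase_arc (hM : IsMatching O (insert c C) M) (hc : c ∉ C)
    (hoc : (o, c) ∈ M) : IsMatching (O.erase o) C (M.erase (o, c)) := by
  obtain ⟨h1, h2, h3, h4, h5⟩ := hM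
  refine ⟨?_, ?_, ?_, ?_, ?_⟩
  · intro a ha
    have := h1 a
    have := h4 a
    have := h5 a
    grind
  · intro x hx
    obtain ⟨d, hd⟩ := h2 x (mem_of_mem_erase hx)
    exact ⟨d, by grind⟩
  · intro x hx
    obtain ⟨d, hd⟩ := h3 x (mem_insert_of_mem hx)
    exact ⟨d, by grind⟩
  · intro a ha b hb
    exact h4 a (mem_of_mem_erase ha) b (mem_of_mem_erase hb)
  · intro a ha b hb
    exact h5 a (mem_of_mem_erase ha) b (mem_of_mem_erase hb)

end InsertArc

lemma matchSum_insert {R : Type*} [CommRing R] (p q : R) (O C : Finset ℕ) (c : ℕ)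
    (hc : ∀ x ∈ C, c < x) :
    matchSum p q O (insert c C) = ∑ o ∈ O.filter (· < c),
      p ^ (O.filter (· < o)).card * q ^ (O.filter fun x => o < x ∧ x < c).card *
        matchSum p q (O.erase o) C := by
  have hcC : c ∉ C := fun h => (hc c h).false
  simp only [matchSum, mul_sum]
  rw [sum_sigma']
  symm
  refine sum_bij (fun x _ => insert (x.1, c) x.2) ?_ ?_ ?_ ?_
  · rintro ⟨o, M⟩ h
    simp only [mem_sigma, mem_filter, mem_matchings] at h ⊢
    exact h.2.insert_arc hcC h.1.1 h.1.2
  · rintro ⟨o, M⟩ h ⟨o', M'⟩ h' heq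
    simp only [mem_sigma, mem_filter, mem_matchings] at h h' heq
    have hM : ∀ y, (y, c) ∉ M := fun y hy => hcC (h.2.1 _ hy).2.1
    have hM' : ∀ y, (y, c) ∉ M' := fun y hy => hcC (h'.2.1 _ hy).2.1
    have hoo : o = o' := by
      have : (o, c) ∈ insert (o', c) M' := heq ▸ mem_insert_self _ _
      rcases mem_insert.1 this with h | h
      · exact (Prod.ext_iff.1 h).1
      · exact absurd h (hM' o)
    subst hoo
    rw [← erase_insert (hM o), heq, erase_insert (hM' o)]
  · intro M hM
    rw [mem_matchings] at hM
    obtain ⟨o, ho⟩ := hM.2.2.1 c (mem_insert_self _ _)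
    refine ⟨⟨o, M.erase (o, c)⟩, ?_, insert_erase ho⟩
    simp only [mem_sigma, mem_filter, mem_matchings]
    exact ⟨⟨(hM.1 _ ho).1, (hM.1 _ ho).2.2⟩, hM.erase_arc hcC ho⟩
  · rintro ⟨o, M⟩ h
    simp only [mem_sigma, mem_filter, mem_matchings] at h
    rw [arcNest_insert h.2 hc, arcCros_insert h.2 hc, pow_add, pow_add]
    ring

/-- The generating polynomial of matchings factors over the closers. -/
lemma matchSum_eq_prod {R : Type*} [CommRing R] (p q : R) (O C : Finset ℕ)
    (h : O.card = C.card) : matchSum p q O C = ∏ c ∈ C, pqInt p q (openCount O C c) := by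
  induction C using Finset.induction_on_min generalizing O with
  | empty =>
    have hO : O = ∅ := by simpa using h
    subst hO
    have : matchings ∅ ∅ = {∅} := by
      ext M
      rw [mem_matchings, mem_singleton]
      constructor
      · intro hM
        exact eq_empty_of_forall_notMem fun a ha => by simpa using (hM.1 a ha).1
      · rintro rfl
        simp [IsMatching]
    simp [matchSum, this, arcNest, arcCros]
  | insert c C hc ih =>
    have hcC : c ∉ C := fun h => (hc c h).false
    rw [card_insert_of_notMem hcC] at h
    rw [matchSum_insert p q O C c hc, prod_insert hcC]
    have hfac : ∀ o ∈ O.filter (· < c), matchSum p q (O.erase o) C =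
        ∏ x ∈ C, pqInt p q (openCount O (insert c C) x) := by
      intro o ho
      rw [mem_filter] at ho
      rw [ih (O.erase o) (by rw [card_erase_of_mem ho.1]; omega)]
      refine prod_congr rfl fun x hx => ?_
      have hcx := hc x hx
      have h1 : (O.erase o).filter (· < x) = (O.filter (· < x)).erase o := filter_erase _ _ _
      have h2 : (insert c C).filter (· < x) = insert c (C.filter (· < x)) := by
        rw [filter_insert, if_pos hcx]
      have h3 : o ∈ O.filter (· < x) := mem_filter.2 ⟨ho.1, ho.2.trans hcx⟩
      have h4 := card_pos.2 ⟨o, h3⟩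
      rw [openCount, openCount, h1, h2, card_erase_of_mem h3,
        card_insert_of_notMem (by simp [hcC])]
      congr 1
      omega
    rw [sum_congr rfl fun o ho => by rw [hfac o ho], ← sum_mul]
    congr 1
    have h5 : openCount O (insert c C) c = (O.filter (· < c)).card := by
      have : (insert c C).filter (· < c) = ∅ := by
        rw [filter_eq_empty_iff]
        intro x hx
        rcases mem_insert.1 hx with rfl | hx
        · exact lt_irrefl _
        · exact (hc x hx).not_gt
      rw [openCount, this, card_empty, Nat.sub_zero]
    rw [h5, ← sum_pow_card_lt_mul_pow_card_gt]
    refine sum_congr rfl fun o ho => ?_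
    rw [mem_filter] at ho
    rw [filter_filter, filter_filter]
    congr 3
    · ext x
      simp only [mem_filter]
      grind
    · ext x
      simp only [mem_filter]
      grind

/-! Excedances and drops of a permutation as matchings. -/

section Perm

variable {n : ℕ} {σ : Equiv.Perm (Fin n)} {i j : ℕ}

lemma pext_of_mem (hi : 1 ≤ i ∧ i ≤ n) :
    pext n σ i = ((σ ⟨i - 1, by omega⟩ : Fin n) : ℕ) + 1 := dif_pos hi

lemma pext_mem (hi : i ∈ Icc 1 n) : pext n σ i ∈ Icc 1 n := by
  rw [mem_Icc] at hi ⊢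
  rw [pext_of_mem hi]
  omega

lemma pext_inv_pext (hi : i ∈ Icc 1 n) : pext n σ⁻¹ (pext n σ i) = i := by
  have h := pext_mem (σ := σ) hi
  rw [mem_Icc] at hi h
  rw [pext_of_mem h]
  simp only [pext_of_mem hi, Nat.add_sub_cancel, Fin.eta, Equiv.Perm.inv_def,
    Equiv.symm_apply_apply]
  omega

lemma pext_pext_inv (hi : i ∈ Icc 1 n) : pext n σ (pext n σ⁻¹ i) = i := by
  simpa using pext_inv_pext (σ := σ⁻¹) hi

lemma pext_injOn (hi : i ∈ Icc 1 n) (hj : j ∈ Icc 1 n) (h : pext n σ i = pext n σ j) :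
    i = j := by
  rw [← pext_inv_pext (σ := σ) hi, h, pext_inv_pext hj]

lemma perm_ext_of_pext {τ : Equiv.Perm (Fin n)}
    (h : ∀ i ∈ Icc 1 n, pext n σ i = pext n τ i) : σ = τ := by
  ext x
  have h1 := h (x + 1) (by rw [mem_Icc]; omega)
  rw [pext_of_mem (by omega), pext_of_mem (by omega)] at h1
  simpa using h1

lemma exists_perm_of_rel (r : ℕ → ℕ → Prop) (h : ∀ i ∈ Icc 1 n, ∃ j ∈ Icc 1 n, r i j)
    (hr : ∀ i i' j, r i j → r i' j → i = i') :
    ∃ σ : Equiv.Perm (Fin n), ∀ i ∈ Icc 1 n, r i (pext n σ i) := by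
  have h' : ∀ x : Fin n, ∃ y : Fin n, r (x + 1) (y + 1) := by
    intro x
    obtain ⟨j, hj, hrj⟩ := h (x + 1) (by rw [mem_Icc]; omega)
    rw [mem_Icc] at hj
    refine ⟨⟨j - 1, by omega⟩, ?_⟩
    rwa [show j - 1 + 1 = j by omega]
  choose f hf using h'
  have hinj : Function.Injective f := by
    intro x y hxy
    have h1 := hf x
    rw [hxy] at h1
    have := hr _ _ _ h1 (hf y)
    exact Fin.ext (by omega)
  refine ⟨Equiv.ofBijective f (Finite.injective_iff_bijective.1 hinj), fun i hi => ?_⟩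
  rw [mem_Icc] at hi
  rw [pext_of_mem hi]
  have := hf ⟨i - 1, by omega⟩
  simpa [show i - 1 + 1 = i by omega] using this

variable (n σ)

/-- The positions of the excedances of `σ`. -/
def excPos : Finset ℕ := (Icc 1 n).filter fun i => i < pext n σ i

/-- The values of the excedances of `σ`. -/
def excVal : Finset ℕ := (Icc 1 n).filter fun i => pext n σ⁻¹ i < i

/-- The arcs `(i, σ i)` of the excedances of `σ`. -/
def upArcs : Finset (ℕ × ℕ) := (pairs n).filter fun x => x.1 < x.2 ∧ pext n σ x.1 = x.2

/-- The arcs `(σ i, i)` of the drops of `σ`. -/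
def downArcs : Finset (ℕ × ℕ) := (pairs n).filter fun x => x.1 < x.2 ∧ pext n σ x.2 = x.1

variable {n σ}

lemma fixStat_eq_zero : fixStat n σ = 0 ↔ ∀ i ∈ Icc 1 n, pext n σ i ≠ i := by
  rw [fixStat, card_eq_zero, filter_eq_empty_iff]

lemma mem_upArcs {a : ℕ × ℕ} :
    a ∈ upArcs n σ ↔ (a.1 ∈ Icc 1 n ∧ a.2 ∈ Icc 1 n) ∧ a.1 < a.2 ∧ pext n σ a.1 = a.2 := by
  rw [upArcs, mem_filter, pairs, mem_product]

lemma mem_downArcs {a : ℕ × ℕ} :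
    a ∈ downArcs n σ ↔ (a.1 ∈ Icc 1 n ∧ a.2 ∈ Icc 1 n) ∧ a.1 < a.2 ∧ pext n σ a.2 = a.1 := by
  rw [downArcs, mem_filter, pairs, mem_product]

lemma pext_inv_ne (hfix : ∀ i ∈ Icc 1 n, pext n σ i ≠ i) (hi : i ∈ Icc 1 n) :
    pext n σ⁻¹ i ≠ i := by
  intro h
  have := pext_pext_inv (σ := σ) hi
  rw [h] at this
  exact hfix i hi this

lemma isMatching_upArcs : IsMatching (excPos n σ) (excVal n σ) (upArcs n σ) := by
  refine ⟨?_, ?_, ?_, ?_, ?_⟩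
  · intro a ha
    rw [mem_upArcs] at ha
    have := pext_inv_pext (σ := σ) ha.1.1
    rw [excPos, excVal, mem_filter, mem_filter]
    grind
  · intro i hi
    rw [excPos, mem_filter] at hi
    exact ⟨pext n σ i, mem_upArcs.2 ⟨⟨hi.1, pext_mem hi.1⟩, hi.2, rfl⟩⟩
  · intro i hi
    rw [excVal, mem_filter] at hi
    exact ⟨pext n σ⁻¹ i, mem_upArcs.2 ⟨⟨pext_mem hi.1, hi.1⟩, hi.2, pext_pext_inv hi.1⟩⟩
  · intro a ha b hb hab
    rw [mem_upArcs] at ha hb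
    exact Prod.ext hab (by rw [← ha.2.2, ← hb.2.2, hab])
  · intro a ha b hb hab
    rw [mem_upArcs] at ha hb
    exact Prod.ext (pext_injOn ha.1.1 hb.1.1 (by rw [ha.2.2, hb.2.2, hab])) hab

lemma isMatching_downArcs (hfix : ∀ i ∈ Icc 1 n, pext n σ i ≠ i) :
    IsMatching (Icc 1 n \ excVal n σ) (Icc 1 n \ excPos n σ) (downArcs n σ) := by
  refine ⟨?_, ?_, ?_, ?_, ?_⟩
  · intro a ha
    rw [mem_downArcs] at ha
    have := pext_inv_pext (σ := σ) ha.1.2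
    rw [excPos, excVal, mem_sdiff, mem_sdiff, mem_filter, mem_filter]
    grind
  · intro i hi
    rw [excVal, mem_sdiff, mem_filter] at hi
    have := pext_inv_ne hfix hi.1
    refine ⟨pext n σ⁻¹ i, mem_downArcs.2 ⟨⟨hi.1, pext_mem hi.1⟩, ?_, pext_pext_inv hi.1⟩⟩
    grind
  · intro i hi
    rw [excPos, mem_sdiff, mem_filter] at hi
    have := hfix i hi.1
    refine ⟨pext n σ i, mem_downArcs.2 ⟨⟨pext_mem hi.1, hi.1⟩, ?_, rfl⟩⟩
    grind
  · intro a ha b hb hab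
    rw [mem_downArcs] at ha hb
    exact Prod.ext hab (pext_injOn ha.1.2 hb.1.2 (by rw [ha.2.2, hb.2.2, hab]))
  · intro a ha b hb hab
    rw [mem_downArcs] at ha hb
    exact Prod.ext (by rw [← ha.2.2, ← hb.2.2, hab]) hab

lemma arcNest_upArcs : arcNest (upArcs n σ) = ((pairs n).filter fun x =>
    x.1 < x.2 ∧ x.2 < pext n σ x.2 ∧ pext n σ x.2 < pext n σ x.1).card := by
  symm
  refine card_nbij' (fun x => ((x.1, pext n σ x.1), (x.2, pext n σ x.2)))
    (fun y => (y.1.1, y.2.1)) ?_ ?_ ?_ ?_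
  · intro x hx
    simp only [coe_filter, Set.mem_ofPred_eq, pairs, mem_product, mem_upArcs] at hx ⊢
    have := pext_mem (σ := σ) hx.1.1
    have := pext_mem (σ := σ) hx.1.2
    grind
  · intro y hy
    simp only [coe_filter, Set.mem_ofPred_eq, pairs, mem_product, mem_upArcs] at hy ⊢
    grind
  · intro x hx
    rfl
  · intro y hy
    simp only [coe_filter, Set.mem_ofPred_eq, mem_product, mem_upArcs] at hy
    simp only [hy.1.1.2.2, hy.1.2.2.2]

lemma arcNest_downArcs : arcNest (downArcs n σ) = ((pairs n).filter fun x =>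
    x.2 < x.1 ∧ pext n σ x.2 < x.2 ∧ pext n σ x.1 < pext n σ x.2).card := by
  symm
  refine card_nbij' (fun x => ((pext n σ x.1, x.1), (pext n σ x.2, x.2)))
    (fun y => (y.1.2, y.2.2)) ?_ ?_ ?_ ?_
  · intro x hx
    simp only [coe_filter, Set.mem_ofPred_eq, pairs, mem_product, mem_downArcs] at hx ⊢
    have := pext_mem (σ := σ) hx.1.1
    have := pext_mem (σ := σ) hx.1.2
    grind
  · intro y hy
    simp only [coe_filter, Set.mem_ofPred_eq, pairs, mem_product, mem_downArcs] at hy ⊢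
    grind
  · intro x hx
    rfl
  · intro y hy
    simp only [coe_filter, Set.mem_ofPred_eq, mem_product, mem_downArcs] at hy
    simp only [hy.1.1.2.2, hy.1.2.2.2]

lemma arcCros_upArcs : arcCros (upArcs n σ) = ((pairs n).filter fun x =>
    x.1 < x.2 ∧ x.2 < pext n σ x.1 ∧ pext n σ x.1 < pext n σ x.2).card := by
  symm
  refine card_nbij' (fun x => ((x.1, pext n σ x.1), (x.2, pext n σ x.2)))
    (fun y => (y.1.1, y.2.1)) ?_ ?_ ?_ ?_
  · intro x hx
    simp only [coe_filter, Set.mem_ofPred_eq, pairs, mem_product, mem_upArcs] at hx ⊢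
    have := pext_mem (σ := σ) hx.1.1
    have := pext_mem (σ := σ) hx.1.2
    grind
  · intro y hy
    simp only [coe_filter, Set.mem_ofPred_eq, pairs, mem_product, mem_upArcs] at hy ⊢
    grind
  · intro x hx
    rfl
  · intro y hy
    simp only [coe_filter, Set.mem_ofPred_eq, mem_product, mem_upArcs] at hy
    simp only [hy.1.1.2.2, hy.1.2.2.2]

lemma arcCros_downArcs : arcCros (downArcs n σ) = ((pairs n).filter fun x =>
    x.2 < x.1 ∧ pext n σ x.1 < x.2 ∧ pext n σ x.2 < pext n σ x.1).card := by
  symm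
  refine card_nbij' (fun x => ((pext n σ x.2, x.2), (pext n σ x.1, x.1)))
    (fun y => (y.2.2, y.1.2)) ?_ ?_ ?_ ?_
  · intro x hx
    simp only [coe_filter, Set.mem_ofPred_eq, pairs, mem_product, mem_downArcs] at hx ⊢
    have := pext_mem (σ := σ) hx.1.1
    have := pext_mem (σ := σ) hx.1.2
    grind
  · intro y hy
    simp only [coe_filter, Set.mem_ofPred_eq, pairs, mem_product, mem_downArcs] at hy ⊢
    grind
  · intro x hx
    rfl
  · intro y hy
    simp only [coe_filter, Set.mem_ofPred_eq, mem_product, mem_downArcs] at hy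
    simp only [hy.1.1.2.2, hy.1.2.2.2]

lemma cdaStat_eq_card_inter : cdaStat n σ = (excPos n σ ∩ excVal n σ).card := by
  rw [cdaStat]
  congr 1
  ext x
  simp only [excPos, excVal, mem_inter, mem_filter]
  tauto

lemma cdaStat_eq_card_pairs : cdaStat n σ = ((pairs n).filter fun x =>
    x.1 < x.2 ∧ x.2 = pext n σ x.1 ∧ pext n σ x.1 < pext n σ x.2).card := by
  refine card_nbij' (fun x => (pext n σ⁻¹ x, x)) Prod.snd ?_ ?_ ?_ ?_
  · intro x hx
    simp only [coe_filter, Set.mem_ofPred_eq, pairs, mem_product] at hx ⊢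
    have := pext_mem (σ := σ⁻¹) hx.1
    have := pext_pext_inv (σ := σ) hx.1
    grind
  · intro y hy
    simp only [coe_filter, Set.mem_ofPred_eq, pairs, mem_product] at hy ⊢
    have := pext_inv_pext (σ := σ) hy.1.1
    grind
  · intro x hx
    rfl
  · intro y hy
    simp only [coe_filter, Set.mem_ofPred_eq, pairs, mem_product] at hy
    exact Prod.ext (by simp only [hy.2.2.1, pext_inv_pext hy.1.1]) rfl

lemma nestStat_eq (hfix : ∀ i ∈ Icc 1 n, pext n σ i ≠ i) :
    nestStat n σ = arcNest (upArcs n σ) + arcNest (downArcs n σ) := by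
  rw [nestStat, arcNest_upArcs, arcNest_downArcs, filter_or, card_union_of_disjoint]
  · congr 2
    refine filter_congr fun x hx => ?_
    have := hfix x.2 (mem_product.1 hx).2
    grind
  · rw [Finset.disjoint_filter]
    grind

lemma crosStat_eq :
    crosStat n σ = arcCros (upArcs n σ) + arcCros (downArcs n σ) + cdaStat n σ := by
  have h : ((pairs n).filter fun x =>
      x.1 < x.2 ∧ x.2 ≤ pext n σ x.1 ∧ pext n σ x.1 < pext n σ x.2).card =
      arcCros (upArcs n σ) + cdaStat n σ := by
    rw [arcCros_upArcs, cdaStat_eq_card_pairs, ← card_union_of_disjoint, ← filter_or]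
    · congr 1
      refine filter_congr fun x _ => ?_
      grind
    · rw [Finset.disjoint_filter]
      grind
  rw [crosStat, arcCros_downArcs, filter_or, card_union_of_disjoint, h]
  · omega
  · rw [Finset.disjoint_filter]
    grind

lemma card_excPos_eq_card_excVal : (excPos n σ).card = (excVal n σ).card := by
  refine card_nbij' (pext n σ) (pext n σ⁻¹) ?_ ?_ ?_ ?_ <;> intro x hx <;>
    simp only [excPos, excVal, coe_filter, Set.mem_ofPred_eq] at hx ⊢
  · exact ⟨pext_mem hx.1, by rw [pext_inv_pext hx.1]; exact hx.2⟩
  · exact ⟨pext_mem hx.1, by rw [pext_pext_inv hx.1]; exact hx.2⟩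
  · exact pext_inv_pext hx.1
  · exact pext_pext_inv hx.1

lemma cvalleyStat_eq (hfix : ∀ i ∈ Icc 1 n, pext n σ i ≠ i) :
    cvalleyStat n σ = (excPos n σ \ excVal n σ).card := by
  rw [cvalleyStat]
  congr 1
  ext x
  simp only [excPos, excVal, mem_sdiff, mem_filter]
  have := pext_inv_ne hfix (i := x)
  grind

/-- A pair of matchings, of `O` with `C` and of the complement of `C` with the complement of `O`,
comes from a derangement. -/
lemma exists_perm_of_matchings {O C : Finset ℕ} (hO : O ⊆ Icc 1 n) (hC : C ⊆ Icc 1 n)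
    {M N : Finset (ℕ × ℕ)} (hM : IsMatching O C M)
    (hN : IsMatching (Icc 1 n \ C) (Icc 1 n \ O) N) :
    ∃ σ : Equiv.Perm (Fin n), (∀ i ∈ Icc 1 n, pext n σ i ≠ i) ∧ excPos n σ = O ∧
      excVal n σ = C ∧ upArcs n σ = M ∧ downArcs n σ = N := by
  obtain ⟨σ, hσ⟩ := exists_perm_of_rel (n := n) (fun i j => (i, j) ∈ M ∨ (j, i) ∈ N)
    (by
      intro i hi
      by_cases h : i ∈ O
      · obtain ⟨c, hc⟩ := hM.2.1 i h
        exact ⟨c, hC (hM.1 _ hc).2.1, Or.inl hc⟩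
      · obtain ⟨c, hc⟩ := hN.2.2.1 i (mem_sdiff.2 ⟨hi, h⟩)
        exact ⟨c, (mem_sdiff.1 (hN.1 _ hc).1).1, Or.inr hc⟩)
    (by
      rintro i i' j (h | h) (h' | h')
      · exact (Prod.ext_iff.1 (hM.2.2.2.2 _ h _ h' rfl)).1
      · exact absurd (hM.1 _ h).2.1 (mem_sdiff.1 (hN.1 _ h').1).2
      · exact absurd (hM.1 _ h').2.1 (mem_sdiff.1 (hN.1 _ h).1).2
      · exact (Prod.ext_iff.1 (hN.2.2.2.1 _ h _ h' rfl)).2)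
  have hM' : ∀ i ∈ Icc 1 n, ((i, pext n σ i) ∈ M ↔ i < pext n σ i) := by
    intro i hi
    refine ⟨fun h => (hM.1 _ h).2.2, fun h => ?_⟩
    rcases hσ i hi with h' | h'
    · exact h'
    · exact absurd (hN.1 _ h').2.2 h.not_gt
  have hN' : ∀ i ∈ Icc 1 n, ((pext n σ i, i) ∈ N ↔ pext n σ i < i) := by
    intro i hi
    refine ⟨fun h => (hN.1 _ h).2.2, fun h => ?_⟩
    rcases hσ i hi with h' | h'
    · exact absurd (hM.1 _ h').2.2 h.not_gt
    · exact h'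
  have hfix : ∀ i ∈ Icc 1 n, pext n σ i ≠ i := by
    intro i hi h
    have h1 := hM' i hi
    have h2 := hN' i hi
    have h3 := hσ i hi
    grind
  have hup : upArcs n σ = M := by
    ext ⟨i, j⟩
    simp only [mem_upArcs]
    constructor
    · rintro ⟨⟨hi, -⟩, hlt, rfl⟩
      exact (hM' i hi).2 hlt
    · intro h
      have hi := hO (hM.1 _ h).1
      have h1 : (i, pext n σ i) ∈ M := by
        rcases hσ i hi with h' | h'
        · exact h'
        · exact absurd (hM.1 _ h).1 (mem_sdiff.1 (hN.1 _ h').2.1).2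
      exact ⟨⟨hi, hC (hM.1 _ h).2.1⟩, (hM.1 _ h).2.2,
        (Prod.ext_iff.1 (hM.2.2.2.1 _ h1 _ h rfl)).2⟩
  have hdown : downArcs n σ = N := by
    ext ⟨j, i⟩
    simp only [mem_downArcs]
    constructor
    · rintro ⟨⟨-, hi⟩, hlt, rfl⟩
      exact (hN' i hi).2 hlt
    · intro h
      have hi := mem_sdiff.1 (hN.1 _ h).2.1
      have h1 : (pext n σ i, i) ∈ N := by
        rcases hσ i hi.1 with h' | h'
        · exact absurd (hM.1 _ h').1 hi.2
        · exact h'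
      exact ⟨⟨(mem_sdiff.1 (hN.1 _ h).1).1, hi.1⟩, (hN.1 _ h).2.2,
        (Prod.ext_iff.1 (hN.2.2.2.2 _ h1 _ h rfl)).1⟩
  have h1 := isMatching_upArcs (σ := σ)
  rw [hup] at h1
  refine ⟨σ, hfix, ?_, ?_, hup, hdown⟩
  · rw [← h1.image_fst, hM.image_fst]
  · ext x
    constructor
    · intro hx
      obtain ⟨o, ho⟩ := h1.2.2.1 x hx
      exact (hM.1 _ ho).2.1
    · intro hx
      obtain ⟨o, ho⟩ := hM.2.2.1 x hx
      exact (h1.1 _ ho).2.1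

lemma perm_ext_of_arcs {τ : Equiv.Perm (Fin n)} (hfix : ∀ i ∈ Icc 1 n, pext n σ i ≠ i)
    (hup : upArcs n σ = upArcs n τ) (hdown : downArcs n σ = downArcs n τ) : σ = τ := by
  refine perm_ext_of_pext fun i hi => ?_
  rcases lt_or_gt_of_ne (hfix i hi) with h | h
  · have : (pext n σ i, i) ∈ downArcs n τ := hdown ▸ mem_downArcs.2 ⟨⟨pext_mem hi, hi⟩, h, rfl⟩
    exact (mem_downArcs.1 this).2.2.symm
  · have : (i, pext n σ i) ∈ upArcs n τ := hup ▸ mem_upArcs.2 ⟨⟨hi, pext_mem hi⟩, h, rfl⟩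
    exact (mem_upArcs.1 this).2.2.symm

end Perm

/-! Grouping derangements by cyclic valleys, cyclic peaks and double excedances. -/

/-- The common weight of the derangements with cyclic valleys `V` and cyclic peaks `P`. -/
def typeWeight {R : Type*} [CommRing R] (p q : R) (n : ℕ) (V P : Finset ℕ) : R :=
  (∏ x ∈ Icc 1 n \ V, pqInt p q (openCount V P x)) * ∏ x ∈ P, pqInt p q (openCount V P x)

/-- The possible pairs (cyclic valleys, cyclic peaks). -/
def valleyPeakPairs (n : ℕ) : Finset (Finset ℕ × Finset ℕ) :=
  ((Icc 1 n).powerset ×ˢ (Icc 1 n).powerset).filter fun x =>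
    Disjoint x.1 x.2 ∧ x.1.card = x.2.card

lemma openCount_sdiff (O C : Finset ℕ) (x : ℕ) :
    openCount (O \ C) (C \ O) x = openCount O C x := by
  have h1 := card_sdiff_add_card_inter (O.filter (· < x)) (C.filter (· < x))
  have h2 := card_sdiff_add_card_inter (C.filter (· < x)) (O.filter (· < x))
  have h3 : (O \ C).filter (· < x) = O.filter (· < x) \ C.filter (· < x) := by
    ext y; simp only [mem_filter, mem_sdiff]; tauto
  have h4 : (C \ O).filter (· < x) = C.filter (· < x) \ O.filter (· < x) := by
    ext y; simp only [mem_filter, mem_sdiff]; tauto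
  rw [inter_comm] at h2
  rw [openCount, openCount, h3, h4]
  omega

lemma openCount_compl {I O C : Finset ℕ} (hO : O ⊆ I) (hC : C ⊆ I) (x : ℕ) :
    openCount (I \ C) (I \ O) x = openCount O C x := by
  have h (S : Finset ℕ) (hS : S ⊆ I) :
      ((I \ S).filter (· < x)).card + (S.filter (· < x)).card = (I.filter (· < x)).card := by
    have : (I \ S).filter (· < x) = I.filter (· < x) \ S.filter (· < x) := by
      ext y; simp only [mem_filter, mem_sdiff]; tauto
    rw [this, card_sdiff_add_card_eq_card (filter_subset_filter _ hS)]
  have h1 := h O hO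
  have h2 := h C hC
  rw [openCount, openCount]
  omega

lemma matchSum_mul_matchSum_compl {R : Type*} [CommRing R] (p q : R) {n : ℕ} {O C : Finset ℕ}
    (hO : O ⊆ Icc 1 n) (hC : C ⊆ Icc 1 n) (h : O.card = C.card) :
    matchSum p q O C * matchSum p q (Icc 1 n \ C) (Icc 1 n \ O) =
      typeWeight p q n (O \ C) (C \ O) := by
  have h1 := card_sdiff_add_card_eq_card hO
  have h2 := card_sdiff_add_card_eq_card hC
  rw [matchSum_eq_prod p q O C h, matchSum_eq_prod p q _ _ (by omega), typeWeight]
  simp only [openCount_sdiff, openCount_compl hO hC]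
  have h3 : Icc 1 n \ (O \ C) = (Icc 1 n \ O) ∪ (C ∩ O) := by
    ext x
    have := @hC x
    simp only [mem_sdiff, mem_union, mem_inter]
    tauto
  have h4 : Disjoint (Icc 1 n \ O) (C ∩ O) := by
    rw [Finset.disjoint_left]
    intro x hx
    simp only [mem_sdiff, mem_inter] at hx ⊢
    tauto
  rw [h3, prod_union h4, ← prod_inter_mul_prod_sdiff C O]
  ring

lemma sum_derangements_excPos_excVal {R : Type*} [CommRing R] (p q : R) {n : ℕ}
    {O C : Finset ℕ} (hO : O ⊆ Icc 1 n) (hC : C ⊆ Icc 1 n) :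
    ∑ σ ∈ Finset.univ.filter (fun σ : Equiv.Perm (Fin n) =>
        fixStat n σ = 0 ∧ excPos n σ = O ∧ excVal n σ = C),
      p ^ nestStat n σ * q ^ crosStat n σ =
      q ^ (O ∩ C).card * (matchSum p q O C * matchSum p q (Icc 1 n \ C) (Icc 1 n \ O)) := by
  rw [matchSum, matchSum, sum_mul_sum, ← sum_product', mul_sum]
  refine sum_bij (fun σ _ => (upArcs n σ, downArcs n σ)) ?_ ?_ ?_ ?_
  · intro σ hσ
    simp only [mem_filter, mem_univ, true_and, fixStat_eq_zero] at hσ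
    obtain ⟨hfix, rfl, rfl⟩ := hσ
    simp only [mem_product, mem_matchings]
    exact ⟨isMatching_upArcs, isMatching_downArcs hfix⟩
  · intro σ hσ τ _ h
    simp only [mem_filter, mem_univ, true_and, fixStat_eq_zero] at hσ
    exact perm_ext_of_arcs hσ.1 (Prod.ext_iff.1 h).1 (Prod.ext_iff.1 h).2
  · rintro ⟨M, N⟩ h
    simp only [mem_product, mem_matchings] at h
    obtain ⟨σ, hfix, h1, h2, h3, h4⟩ := exists_perm_of_matchings hO hC h.1 h.2
    refine ⟨σ, ?_, by rw [h3, h4]⟩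
    simp only [mem_filter, mem_univ, true_and, fixStat_eq_zero]
    exact ⟨hfix, h1, h2⟩
  · intro σ hσ
    simp only [mem_filter, mem_univ, true_and, fixStat_eq_zero] at hσ
    obtain ⟨hfix, rfl, rfl⟩ := hσ
    rw [nestStat_eq hfix, crosStat_eq, cdaStat_eq_card_inter]
    ring

/-- The derangements with prescribed cyclic valleys `V`, cyclic peaks `P` and double
excedances `A`. -/
def typeClass (n : ℕ) (V P A : Finset ℕ) : Finset (Equiv.Perm (Fin n)) :=
  Finset.univ.filter fun σ => fixStat n σ = 0 ∧ excPos n σ \ excVal n σ = V ∧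
    excVal n σ \ excPos n σ = P ∧ excPos n σ ∩ excVal n σ = A

lemma mem_valleyPeakPairs {n : ℕ} {V P : Finset ℕ} : (V, P) ∈ valleyPeakPairs n ↔
    (V ⊆ Icc 1 n ∧ P ⊆ Icc 1 n) ∧ Disjoint V P ∧ V.card = P.card := by
  simp [valleyPeakPairs]

lemma sum_typeClass {R : Type*} [CommRing R] (p q : R) {n : ℕ} {V P A : Finset ℕ}
    (hVP : (V, P) ∈ valleyPeakPairs n) (hA : A ⊆ Icc 1 n \ (V ∪ P)) :
    ∑ σ ∈ typeClass n V P A, p ^ nestStat n σ * q ^ crosStat n σ =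
      q ^ A.card * typeWeight p q n V P := by
  obtain ⟨⟨hV, hP⟩, hdisj, hcard⟩ := mem_valleyPeakPairs.1 hVP
  have hA' : ∀ x ∈ A, x ∈ Icc 1 n ∧ x ∉ V ∧ x ∉ P := by
    intro x hx
    have := hA hx
    simp only [mem_sdiff, mem_union] at this
    tauto
  have hd : ∀ x ∈ V, x ∉ P := fun x hx => Finset.disjoint_left.1 hdisj hx
  have h1 : typeClass n V P A = Finset.univ.filter (fun σ : Equiv.Perm (Fin n) =>
      fixStat n σ = 0 ∧ excPos n σ = V ∪ A ∧ excVal n σ = P ∪ A) := by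
    refine filter_congr fun σ _ => and_congr_right fun _ => ?_
    constructor
    · rintro ⟨rfl, rfl, rfl⟩
      refine ⟨(sdiff_union_inter _ _).symm, ?_⟩
      rw [inter_comm, sdiff_union_inter]
    · rintro ⟨h1, h2⟩
      rw [h1, h2]
      refine ⟨?_, ?_, ?_⟩ <;> ext x <;> have := hA' x <;> have := hd x <;>
        simp only [mem_sdiff, mem_union, mem_inter] <;> grind
  have hAI : A ⊆ Icc 1 n := fun x hx => (hA' x hx).1
  have h2 : (V ∪ A) ∩ (P ∪ A) = A := by
    ext x
    have := hd x
    simp only [mem_union, mem_inter]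
    grind
  have h3 : (V ∪ A) \ (P ∪ A) = V := by
    ext x
    have := hA' x
    have := hd x
    simp only [mem_union, mem_sdiff]
    grind
  have h4 : (P ∪ A) \ (V ∪ A) = P := by
    ext x
    have := hA' x
    have := hd x
    simp only [mem_union, mem_sdiff]
    grind
  have hVA : Disjoint V A := Finset.disjoint_right.2 fun x hx => (hA' x hx).2.1
  have hPA : Disjoint P A := Finset.disjoint_right.2 fun x hx => (hA' x hx).2.2
  have hO := union_subset hV hAI
  have hC := union_subset hP hAI
  have hOC : (V ∪ A).card = (P ∪ A).card := by
    rw [card_union_of_disjoint hVA, card_union_of_disjoint hPA, hcard]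
  have h5 := sum_derangements_excPos_excVal p q hO hC
  rw [matchSum_mul_matchSum_compl p q hO hC hOC, h2, h3, h4] at h5
  rw [h1, h5]

lemma excStat_of_mem_typeClass {n : ℕ} {V P A : Finset ℕ} {σ : Equiv.Perm (Fin n)}
    (h : σ ∈ typeClass n V P A) : excStat n σ = V.card + A.card := by
  simp only [typeClass, mem_filter] at h
  rw [← h.2.2.1, ← h.2.2.2.2, card_sdiff_add_card_inter]
  rfl

lemma excPos_subset {n : ℕ} {σ : Equiv.Perm (Fin n)} : excPos n σ ⊆ Icc 1 n :=
  filter_subset _ _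

lemma excVal_subset {n : ℕ} {σ : Equiv.Perm (Fin n)} : excVal n σ ⊆ Icc 1 n :=
  filter_subset _ _

lemma sdiff_mem_valleyPeakPairs {n : ℕ} (σ : Equiv.Perm (Fin n)) :
    (excPos n σ \ excVal n σ, excVal n σ \ excPos n σ) ∈ valleyPeakPairs n := by
  refine mem_valleyPeakPairs.2 ⟨⟨sdiff_subset.trans excPos_subset,
    sdiff_subset.trans excVal_subset⟩, disjoint_sdiff_sdiff, ?_⟩
  have h1 := card_sdiff_add_card_inter (excPos n σ) (excVal n σ)
  have h2 := card_sdiff_add_card_inter (excVal n σ) (excPos n σ)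
  rw [inter_comm, ← card_excPos_eq_card_excVal] at h2
  omega

lemma card_sdiff_union_valleyPeakPairs {n : ℕ} {V P : Finset ℕ}
    (h : (V, P) ∈ valleyPeakPairs n) :
    (Icc 1 n \ (V ∪ P)).card + 2 * V.card = n := by
  obtain ⟨⟨hV, hP⟩, hdisj, hcard⟩ := mem_valleyPeakPairs.1 h
  have := card_sdiff_add_card_eq_card (union_subset hV hP)
  rw [card_union_of_disjoint hdisj, Nat.card_Icc] at this
  omega

/-- The derangement polynomial as a sum over pairs (cyclic valleys, cyclic peaks). -/
lemma sum_derangements {R : Type*} [CommRing R] (p q t : R) (n : ℕ) :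
    ∑ σ ∈ Finset.univ.filter (fun σ : Equiv.Perm (Fin n) => fixStat n σ = 0),
      p ^ nestStat n σ * q ^ crosStat n σ * t ^ excStat n σ =
    ∑ x ∈ valleyPeakPairs n,
      typeWeight p q n x.1 x.2 * t ^ x.1.card * (1 + q * t) ^ (n - 2 * x.1.card) := by
  rw [← sum_fiberwise_of_maps_to (t := valleyPeakPairs n)
    (g := fun σ => (excPos n σ \ excVal n σ, excVal n σ \ excPos n σ))
    (fun σ _ => sdiff_mem_valleyPeakPairs σ)]
  refine sum_congr rfl ?_
  rintro ⟨V, P⟩ hVP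
  have hcard := card_sdiff_union_valleyPeakPairs hVP
  rw [← sum_fiberwise_of_maps_to (t := (Icc 1 n \ (V ∪ P)).powerset)
    (g := fun σ => excPos n σ ∩ excVal n σ)]
  · have hA : ∀ A ∈ (Icc 1 n \ (V ∪ P)).powerset, _ = _ := fun A hA =>
      sum_typeClass p q hVP (mem_powerset.1 hA)
    have h2 : (1 + q * t) ^ (n - 2 * V.card) =
        ∑ A ∈ (Icc 1 n \ (V ∪ P)).powerset, (q * t) ^ A.card := by
      have := sum_pow_mul_eq_add_pow (q * t) 1 (Icc 1 n \ (V ∪ P))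
      simp only [one_pow, mul_one] at this
      rw [this, add_comm, show n - 2 * V.card = (Icc 1 n \ (V ∪ P)).card by omega]
    rw [h2, mul_sum]
    refine sum_congr rfl fun A hA' => ?_
    have h3 : ∀ σ ∈ typeClass n V P A,
        p ^ nestStat n σ * q ^ crosStat n σ * t ^ excStat n σ =
        p ^ nestStat n σ * q ^ crosStat n σ * t ^ (V.card + A.card) := fun σ hσ => by
      rw [excStat_of_mem_typeClass hσ]
    have h4 : typeWeight p q n V P * t ^ V.card * (q * t) ^ A.card =
        ∑ σ ∈ typeClass n V P A,
          p ^ nestStat n σ * q ^ crosStat n σ * t ^ excStat n σ := by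
      rw [sum_congr rfl h3, ← sum_mul, hA A hA']
      ring
    rw [h4]
    refine sum_congr ?_ fun _ _ => rfl
    ext σ
    simp only [typeClass, mem_filter, mem_univ, true_and, Prod.mk.injEq]
    tauto
  · intro σ hσ
    simp only [mem_filter, Prod.mk.injEq] at hσ
    obtain ⟨-, rfl, rfl⟩ := hσ
    rw [mem_powerset]
    intro x hx
    have := excPos_subset (mem_inter.1 hx).1
    simp only [mem_sdiff, mem_union, mem_inter] at hx ⊢
    tauto

open MvPolynomial in
lemma bPoly0_eq (n k : ℕ) : bPoly0 n k =
    ∑ x ∈ (valleyPeakPairs n).filter (fun x => x.1.card = k),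
      typeWeight (X 0) (X 1) n x.1 x.2 := by
  rw [bPoly0, ← sum_fiberwise_of_maps_to
    (t := (valleyPeakPairs n).filter (fun x => x.1.card = k))
    (g := fun σ => (excPos n σ \ excVal n σ, excVal n σ \ excPos n σ))]
  · refine sum_congr rfl ?_
    rintro ⟨V, P⟩ hVP
    rw [mem_filter] at hVP
    have h := sum_typeClass (X 0 : MvPolynomial (Fin 3) ℤ) (X 1) hVP.1 (empty_subset _)
    rw [card_empty, pow_zero, one_mul] at h
    rw [← h]
    refine sum_congr ?_ fun _ _ => rfl
    ext σ
    simp only [typeClass, mem_filter, mem_univ, true_and, Prod.mk.injEq,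
      cdaStat_eq_card_inter, card_eq_zero]
    constructor
    · tauto
    · rintro ⟨h1, h2, h3, h4⟩
      refine ⟨⟨h1, ?_, h4⟩, h2, h3⟩
      rw [cvalleyStat_eq (fixStat_eq_zero.1 h1), h2]
      exact hVP.2
  · intro σ hσ
    simp only [mem_filter, mem_univ, true_and] at hσ
    refine mem_filter.2 ⟨sdiff_mem_valleyPeakPairs σ, ?_⟩
    rw [← hσ.2.1, cvalleyStat_eq (fixStat_eq_zero.1 hσ.1)]

open MvPolynomial in
theorem statement8 (n : ℕ) (hn : 1 ≤ n) :
    (∑ σ ∈ Finset.univ.filter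
        (fun σ : Equiv.Perm (Fin n) => fixStat n σ = 0),
      (X 0 : MvPolynomial (Fin 3) ℤ) ^ nestStat n σ * X 1 ^ crosStat n σ *
        X 2 ^ excStat n σ) =
      ∑ k ∈ Finset.range (n / 2 + 1),
        bPoly0 n k * X 2 ^ k * (1 + X 1 * X 2) ^ (n - 2 * k) := by
  rw [sum_derangements, ← sum_fiberwise_of_maps_to (t := Finset.range (n / 2 + 1))
    (g := fun x : Finset ℕ × Finset ℕ => x.1.card)]
  · refine sum_congr rfl fun k _ => ?_
    rw [bPoly0_eq, sum_mul, sum_mul]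
    refine sum_congr rfl fun x hx => ?_
    rw [(mem_filter.1 hx).2]
  · rintro ⟨V, P⟩ hVP
    have := card_sdiff_union_valleyPeakPairs hVP
    simp only [Finset.mem_range]
    omega

end SZpaper
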